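/- (Theorem 3: O(1/k²) convergence of CONCORD-FISTA with constant step size.) Let C be a convex set of symmetric p×p matrices whose diagonal entries all lie in [a, b] with 0 < a ≤ b, and set L = a^{-2} + ‖S‖₂. Define sequences by Θ^{(1)} = Ω^{(0)}, α_1 = 1, and for k ≥ 1: Ω^{(k)} = argmin over symmetric Θ of { h2(Θ) + (L/2)‖Θ − (Θ^{(k)} − (1/L)∇h1(Θ^{(k)}))‖_F² }, α_{k+1} = (1 + √(1 + 4α_k²))/2, and Θ^{(k+1)} = Ω^{(k)} + ((α_k − 1)/α_{k+1})(Ω^{(k)} − Ω^{(k−1)}). Suppose all Ω^{(k)} and Θ^{(k)} lie in C, and Ω* ∈ C minimizes Q over C. Then for every k ≥ 1, Q(Ω^{(k)}) − Q(Ω*) ≤ 2L ‖Ω^{(0)} − Ω*‖_F² / (k+1)². -/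

import Mathlib

open Finset Matrix

/-- The smooth part of the CONCORD objective:
`h1(Ω) = −Σ_i log|ω_ii| + (1/2) tr(ΩSΩ)`. -/
noncomputable def h1 {p : ℕ} (S Ω : Matrix (Fin p) (Fin p) ℝ) : ℝ :=
  -(∑ i, Real.log |Ω i i|) + (1 / 2) * (Ω * S * Ω).trace

/-- The nonsmooth part of the CONCORD objective: `h2(Ω) = λ Σ_{i≠j} |ω_ij|`. -/
noncomputable def h2 {p : ℕ} (lam : ℝ) (Ω : Matrix (Fin p) (Fin p) ℝ) : ℝ :=
  lam * ∑ i, ∑ j ∈ Finset.univ.filter (fun j => j ≠ i), |Ω i j|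

/-- The CONCORD objective `Q = h1 + h2`. -/
noncomputable def Qobj {p : ℕ} (S : Matrix (Fin p) (Fin p) ℝ) (lam : ℝ)
    (Ω : Matrix (Fin p) (Fin p) ℝ) : ℝ :=
  h1 S Ω + h2 lam Ω

/-- The gradient of the smooth part of the CONCORD objective:
`∇h1(Ω) = −Ω_D⁻¹ + (1/2)(SΩ + ΩS)`. -/
noncomputable def gradH1 {p : ℕ} (S Ω : Matrix (Fin p) (Fin p) ℝ) :
    Matrix (Fin p) (Fin p) ℝ :=
  -(Matrix.diagonal fun i => Ω i i)⁻¹ + (1 / 2 : ℝ) • (S * Ω + Ω * S)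

/-- The squared Frobenius norm `‖A‖_F² = Σ_{i,j} a_ij²`. -/
def frobSq {p : ℕ} (A : Matrix (Fin p) (Fin p) ℝ) : ℝ :=
  ∑ i, ∑ j, (A i j) ^ 2

/-- The spectral norm of a positive semidefinite real symmetric matrix:
its largest eigenvalue. -/
noncomputable def specNorm {p : ℕ} (S : Matrix (Fin p) (Fin p) ℝ)
    (hS : S.IsHermitian) : ℝ :=
  ⨆ i, hS.eigenvalues i

section Log

/-- The function `-log` has a `(a ^ 2)⁻¹`-Lipschitz derivative on `[a, ∞)`. -/
lemma neg_log_le_quadratic {a x y : ℝ} (ha : 0 < a) (hx : a ≤ x) (hy : a ≤ y) :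
    -Real.log x ≤ -Real.log y - (x - y) / y + (a ^ 2)⁻¹ / 2 * (x - y) ^ 2 := by
  have hy0 : 0 < y := ha.trans_le hy
  let F : ℝ → ℝ := fun t => Real.log t - (t - y) / y + (a ^ 2)⁻¹ / 2 * (t - y) ^ 2
  have hF : ∀ t, a ≤ t → HasDerivAt F ((t - y) * ((a ^ 2)⁻¹ - (t * y)⁻¹)) t := by
    intro t ht
    have ht0 : 0 < t := ha.trans_le ht
    have h1 := Real.hasDerivAt_log ht0.ne'
    have h2 : HasDerivAt (fun t : ℝ => t - y) 1 t := (hasDerivAt_id t).sub_const y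
    have h3 := (h1.sub (h2.div_const y)).add ((h2.pow 2).const_mul ((a ^ 2)⁻¹ / 2))
    refine h3.congr_deriv ?_
    rw [mul_inv]
    field_simp
    ring
  have hcoef : ∀ t, a ≤ t → 0 ≤ (a ^ 2)⁻¹ - (t * y)⁻¹ := by
    intro t ht
    have : (t * y)⁻¹ ≤ (a ^ 2)⁻¹ := by
      apply inv_anti₀ (by positivity)
      nlinarith
    linarith
  have hmin : F y ≤ F x := by
    rcases le_total y x with hxy | hxy
    · have hmono : MonotoneOn F (Set.Icc y x) := by
        apply monotoneOn_of_deriv_nonneg (convex_Icc y x)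
        · intro t ht
          exact (hF t (hy.trans ht.1)).continuousAt.continuousWithinAt
        · intro t ht
          rw [interior_Icc] at ht
          exact (hF t (hy.trans ht.1.le)).differentiableAt.differentiableWithinAt
        · intro t ht
          rw [interior_Icc] at ht
          rw [(hF t (hy.trans ht.1.le)).deriv]
          exact mul_nonneg (by linarith [ht.1]) (hcoef t (hy.trans ht.1.le))
      exact hmono (Set.left_mem_Icc.2 hxy) (Set.right_mem_Icc.2 hxy) hxy
    · have hanti : AntitoneOn F (Set.Icc x y) := by
        apply antitoneOn_of_deriv_nonpos (convex_Icc x y)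
        · intro t ht
          exact (hF t (hx.trans ht.1)).continuousAt.continuousWithinAt
        · intro t ht
          rw [interior_Icc] at ht
          exact (hF t (hx.trans ht.1.le)).differentiableAt.differentiableWithinAt
        · intro t ht
          rw [interior_Icc] at ht
          rw [(hF t (hx.trans ht.1.le)).deriv]
          exact mul_nonpos_of_nonpos_of_nonneg (by linarith [ht.2])
            (hcoef t (hx.trans ht.1.le))
      exact hanti (Set.left_mem_Icc.2 hxy) (Set.right_mem_Icc.2 hxy) hxy
  simp only [F, sub_self, zero_div] at hmin
  linarith

lemma neg_log_ge_tangent {x y : ℝ} (hx : 0 < x) (hy : 0 < y) :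
    -Real.log y - (x - y) / y ≤ -Real.log x := by
  have h := Real.log_le_sub_one_of_pos (div_pos hx hy)
  rw [Real.log_div hx.ne' hy.ne'] at h
  have : (x - y) / y = x / y - 1 := by field_simp
  linarith

end Log

section Frobenius

variable {p : ℕ}

/-- The Frobenius inner product. -/
def frobInner (A B : Matrix (Fin p) (Fin p) ℝ) : ℝ :=
  ∑ i, ∑ j, A i j * B i j

lemma frobSq_nonneg (A : Matrix (Fin p) (Fin p) ℝ) : 0 ≤ frobSq A :=
  Finset.sum_nonneg fun _ _ => Finset.sum_nonneg fun _ _ => sq_nonneg _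

lemma frobInner_eq_trace (A B : Matrix (Fin p) (Fin p) ℝ) :
    frobInner A B = (A * Bᵀ).trace := by
  simp [frobInner, Matrix.trace, Matrix.mul_apply]

lemma frobSq_eq_frobInner (A : Matrix (Fin p) (Fin p) ℝ) : frobSq A = frobInner A A := by
  simp [frobSq, frobInner, sq]

lemma frobInner_add_left (A B D : Matrix (Fin p) (Fin p) ℝ) :
    frobInner (A + B) D = frobInner A D + frobInner B D := by
  simp [frobInner_eq_trace, add_mul]

lemma frobInner_sub_left (A B D : Matrix (Fin p) (Fin p) ℝ) :
    frobInner (A - B) D = frobInner A D - frobInner B D := by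
  simp [frobInner_eq_trace, sub_mul]

lemma frobInner_smul_left (c : ℝ) (A D : Matrix (Fin p) (Fin p) ℝ) :
    frobInner (c • A) D = c * frobInner A D := by
  simp [frobInner_eq_trace]

lemma frobInner_comm (A B : Matrix (Fin p) (Fin p) ℝ) : frobInner A B = frobInner B A := by
  simp only [frobInner, mul_comm]

lemma frobInner_add_right (A B D : Matrix (Fin p) (Fin p) ℝ) :
    frobInner D (A + B) = frobInner D A + frobInner D B := by
  simp only [frobInner_comm D, frobInner_add_left]

lemma frobInner_sub_right (A B D : Matrix (Fin p) (Fin p) ℝ) :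
    frobInner D (A - B) = frobInner D A - frobInner D B := by
  simp only [frobInner_comm D, frobInner_sub_left]

lemma frobInner_smul_right (c : ℝ) (A D : Matrix (Fin p) (Fin p) ℝ) :
    frobInner D (c • A) = c * frobInner D A := by
  simp only [frobInner_comm D, frobInner_smul_left]

end Frobenius

section Quadratic

variable {p : ℕ} {S : Matrix (Fin p) (Fin p) ℝ}

lemma specNorm_nonneg (hS : S.PosSemidef) : 0 ≤ specNorm S hS.1 :=
  Real.iSup_nonneg fun i => hS.eigenvalues_nonneg i

lemma posSemidef_specNorm_smul_one_sub (hS : S.IsHermitian) :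
    (specNorm S hS • (1 : Matrix (Fin p) (Fin p) ℝ) - S).PosSemidef := by
  have hdiag : (Matrix.diagonal fun i => specNorm S hS - hS.eigenvalues i).PosSemidef := by
    apply Matrix.PosSemidef.diagonal
    intro i
    exact sub_nonneg.2 (le_ciSup (Set.finite_range _).bddAbove i)
  have h := hdiag.mul_mul_conjTranspose_same
    (hS.eigenvectorUnitary : Matrix (Fin p) (Fin p) ℝ)
  convert h using 1
  have hU : (hS.eigenvectorUnitary : Matrix (Fin p) (Fin p) ℝ) *
      (hS.eigenvectorUnitary : Matrix (Fin p) (Fin p) ℝ)ᴴ = 1 :=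
    Unitary.coe_mul_star_self hS.eigenvectorUnitary
  have hsub : (Matrix.diagonal fun i => specNorm S hS - hS.eigenvalues i) =
      specNorm S hS • (1 : Matrix (Fin p) (Fin p) ℝ) - Matrix.diagonal hS.eigenvalues := by
    rw [Matrix.smul_one_eq_diagonal, Matrix.diagonal_sub]
  have hspec : S = (hS.eigenvectorUnitary : Matrix (Fin p) (Fin p) ℝ) *
      Matrix.diagonal hS.eigenvalues *
      (hS.eigenvectorUnitary : Matrix (Fin p) (Fin p) ℝ)ᴴ := by
    simpa [Unitary.conjStarAlgAut_apply, Function.comp_def, Matrix.star_eq_conjTranspose]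
      using hS.spectral_theorem
  rw [hsub, mul_sub, sub_mul, ← hspec, mul_smul_comm, smul_mul_assoc, mul_one, hU]

lemma trace_mul_mul_nonneg (hS : S.PosSemidef) {D : Matrix (Fin p) (Fin p) ℝ}
    (hD : D.IsSymm) : 0 ≤ (D * S * D).trace := by
  have h := (hS.mul_mul_conjTranspose_same D).trace_nonneg
  rwa [Matrix.conjTranspose_eq_transpose_of_trivial, hD.eq] at h

lemma trace_mul_mul_le (hS : S.IsHermitian) {D : Matrix (Fin p) (Fin p) ℝ}
    (hD : D.IsSymm) : (D * S * D).trace ≤ specNorm S hS * frobSq D := by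
  have h := trace_mul_mul_nonneg (posSemidef_specNorm_smul_one_sub hS) hD
  rw [mul_sub, sub_mul, Matrix.trace_sub, mul_smul_comm, mul_one, smul_mul_assoc,
    Matrix.trace_smul, smul_eq_mul] at h
  rw [frobSq_eq_frobInner, frobInner_eq_trace, hD.eq]
  linarith

lemma trace_mul_mul_expand {X Y : Matrix (Fin p) (Fin p) ℝ}
    (hX : X.IsSymm) (hY : Y.IsSymm) :
    (X * S * X).trace = (Y * S * Y).trace + frobInner (S * Y + Y * S) (X - Y)
      + ((X - Y) * S * (X - Y)).trace := by
  rw [frobInner_eq_trace, Matrix.transpose_sub, hX.eq, hY.eq]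
  simp only [add_mul, mul_sub, sub_mul, Matrix.trace_add, Matrix.trace_sub]
  have h1 : (S * Y * X).trace = (X * S * Y).trace := by
    rw [Matrix.trace_mul_comm, Matrix.mul_assoc]
  have h2 : (S * Y * Y).trace = (Y * S * Y).trace := by
    rw [Matrix.trace_mul_comm, Matrix.mul_assoc]
  rw [h1, h2]
  ring

end Quadratic

section Smooth

variable {p : ℕ} {S X Y : Matrix (Fin p) (Fin p) ℝ}

lemma frobInner_gradH1 (hY : ∀ i, Y i i ≠ 0) (D : Matrix (Fin p) (Fin p) ℝ) :
    frobInner (gradH1 S Y) D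
      = -(∑ i, D i i / Y i i) + (1 / 2) * frobInner (S * Y + Y * S) D := by
  have hinv : (Matrix.diagonal fun i => Y i i)⁻¹ = Matrix.diagonal fun i => (Y i i)⁻¹ := by
    apply Matrix.inv_eq_right_inv
    simp [Matrix.diagonal_mul_diagonal, hY]
  rw [gradH1, hinv, frobInner_add_left, frobInner_smul_left]
  congr 1
  simp [frobInner, Matrix.diagonal_apply, div_eq_inv_mul]

lemma h1_le_quadratic (hS : S.IsHermitian) (hX : X.IsSymm) (hY : Y.IsSymm) {a : ℝ}
    (ha : 0 < a) (hXa : ∀ i, a ≤ X i i) (hYa : ∀ i, a ≤ Y i i) :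
    h1 S X ≤ h1 S Y + frobInner (gradH1 S Y) (X - Y)
      + ((a ^ 2)⁻¹ + specNorm S hS) / 2 * frobSq (X - Y) := by
  have hlog : -(∑ i, Real.log |X i i|) ≤ -(∑ i, Real.log |Y i i|)
      - (∑ i, (X - Y) i i / Y i i) + (a ^ 2)⁻¹ / 2 * ∑ i, (X - Y) i i ^ 2 := by
    rw [Finset.mul_sum, ← Finset.sum_neg_distrib, ← Finset.sum_neg_distrib,
      ← Finset.sum_sub_distrib, ← Finset.sum_add_distrib]
    refine Finset.sum_le_sum fun i _ => ?_
    rw [Real.log_abs, Real.log_abs]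
    exact neg_log_le_quadratic ha (hXa i) (hYa i)
  have hdiag : ∑ i, (X - Y) i i ^ 2 ≤ frobSq (X - Y) :=
    Finset.sum_le_sum fun i _ => Finset.single_le_sum
      (f := fun j => (X - Y) i j ^ 2) (fun _ _ => sq_nonneg _) (Finset.mem_univ i)
  have hdiag' : (a ^ 2)⁻¹ / 2 * ∑ i, (X - Y) i i ^ 2 ≤ (a ^ 2)⁻¹ / 2 * frobSq (X - Y) :=
    mul_le_mul_of_nonneg_left hdiag (by positivity)
  have hquad := trace_mul_mul_le hS (hX.sub hY)
  rw [h1, h1, frobInner_gradH1 fun i => (ha.trans_le (hYa i)).ne',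
    trace_mul_mul_expand hX hY]
  linarith

lemma h1_ge_tangent (hS : S.PosSemidef) (hX : X.IsSymm) (hY : Y.IsSymm)
    (hXpos : ∀ i, 0 < X i i) (hYpos : ∀ i, 0 < Y i i) :
    h1 S Y + frobInner (gradH1 S Y) (X - Y) ≤ h1 S X := by
  have hlog : -(∑ i, Real.log |Y i i|) - (∑ i, (X - Y) i i / Y i i)
      ≤ -(∑ i, Real.log |X i i|) := by
    rw [← Finset.sum_neg_distrib, ← Finset.sum_neg_distrib, ← Finset.sum_sub_distrib]
    refine Finset.sum_le_sum fun i _ => ?_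
    rw [Real.log_abs, Real.log_abs]
    exact neg_log_ge_tangent (hXpos i) (hYpos i)
  have hquad := trace_mul_mul_nonneg hS (hX.sub hY)
  rw [h1, h1, frobInner_gradH1 fun i => (hYpos i).ne', trace_mul_mul_expand hX hY]
  linarith

end Smooth

section Proximal

variable {p : ℕ}

lemma h2_segment_le {lam : ℝ} (hlam : 0 ≤ lam) (X Z : Matrix (Fin p) (Fin p) ℝ) {t : ℝ}
    (ht0 : 0 ≤ t) (ht1 : t ≤ 1) :
    h2 lam (X + t • (Z - X)) ≤ (1 - t) * h2 lam X + t * h2 lam Z := by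
  have hsum : ∑ i, ∑ j ∈ Finset.univ.filter (fun j => j ≠ i), |(X + t • (Z - X)) i j|
      ≤ (1 - t) * (∑ i, ∑ j ∈ Finset.univ.filter (fun j => j ≠ i), |X i j|)
        + t * ∑ i, ∑ j ∈ Finset.univ.filter (fun j => j ≠ i), |Z i j| := by
    simp only [Finset.mul_sum, ← Finset.sum_add_distrib]
    refine Finset.sum_le_sum fun i _ => Finset.sum_le_sum fun j _ => ?_
    have hij : (X + t • (Z - X)) i j = (1 - t) * X i j + t * Z i j := by
      simp only [Matrix.add_apply, Matrix.smul_apply, Matrix.sub_apply, smul_eq_mul]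
      ring
    rw [hij]
    refine (abs_add_le _ _).trans_eq ?_
    rw [abs_mul, abs_mul, abs_of_nonneg ht0, abs_of_nonneg (sub_nonneg.2 ht1)]
  have := mul_le_mul_of_nonneg_left hsum hlam
  simp only [h2]
  linarith

/-- First-order optimality condition for the proximal map of `h2` over symmetric matrices. -/
lemma h2_prox_variational {lam : ℝ} (hlam : 0 ≤ lam) {L : ℝ} (hL : 0 ≤ L)
    {X W Z : Matrix (Fin p) (Fin p) ℝ} (hX : X.IsSymm) (hZ : Z.IsSymm)
    (hmin : ∀ Θ : Matrix (Fin p) (Fin p) ℝ, Θ.IsSymm →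
      h2 lam X + (L / 2) * frobSq (X - W) ≤ h2 lam Θ + (L / 2) * frobSq (Θ - W)) :
    h2 lam X ≤ h2 lam Z + L * frobInner (X - W) (Z - X) := by
  have hbound : ∀ t : ℝ, 0 < t → t ≤ 1 →
      h2 lam X ≤ h2 lam Z + L * frobInner (X - W) (Z - X)
        + t * (L / 2 * frobSq (Z - X)) := by
    intro t ht0 ht1
    have h := hmin (X + t • (Z - X)) (hX.add ((hZ.sub hX).smul t))
    have hconv := h2_segment_le hlam X Z ht0.le ht1
    have hexp : frobSq (X + t • (Z - X) - W) = frobSq (X - W)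
        + 2 * t * frobInner (X - W) (Z - X) + t ^ 2 * frobSq (Z - X) := by
      rw [show X + t • (Z - X) - W = (X - W) + t • (Z - X) by abel]
      simp only [frobSq_eq_frobInner, frobInner_add_left, frobInner_add_right,
        frobInner_smul_left, frobInner_smul_right, frobInner_comm (Z - X) (X - W)]
      ring
    rw [hexp] at h
    refine le_of_mul_le_mul_left ?_ ht0
    linarith
  refine le_of_forall_pos_le_add fun ε hε => ?_
  set M := L / 2 * frobSq (Z - X) with hM
  have hM0 : 0 ≤ M := mul_nonneg (by linarith) (frobSq_nonneg _)
  have ht : 0 < ε / (M + ε) := by positivity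
  have ht1 : ε / (M + ε) ≤ 1 := (div_le_one (by positivity)).2 (by linarith)
  have htM : ε / (M + ε) * M ≤ ε := by
    rw [div_mul_eq_mul_div, div_le_iff₀ (by positivity)]
    nlinarith [sq_nonneg ε]
  linarith [hbound _ ht ht1]

/-- The basic inequality for one proximal gradient step on the CONCORD objective. -/
lemma Qobj_prox_step_le {S X Y Z : Matrix (Fin p) (Fin p) ℝ} (hS : S.PosSemidef)
    {lam : ℝ} (hlam : 0 ≤ lam) {a L : ℝ} (ha : 0 < a)
    (hL : L = (a ^ 2)⁻¹ + specNorm S hS.1)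
    (hX : X.IsSymm) (hY : Y.IsSymm) (hZ : Z.IsSymm)
    (hXa : ∀ i, a ≤ X i i) (hYa : ∀ i, a ≤ Y i i) (hZpos : ∀ i, 0 < Z i i)
    (hmin : ∀ Θ : Matrix (Fin p) (Fin p) ℝ, Θ.IsSymm →
      h2 lam X + (L / 2) * frobSq (X - (Y - (1 / L) • gradH1 S Y))
        ≤ h2 lam Θ + (L / 2) * frobSq (Θ - (Y - (1 / L) • gradH1 S Y))) :
    Qobj S lam X ≤ Qobj S lam Z + L / 2 * (frobSq (Z - Y) - frobSq (Z - X)) := by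
  have hL0 : 0 < L := by
    have := specNorm_nonneg hS
    rw [hL]
    positivity
  have hprox := h2_prox_variational hlam hL0.le hX hZ hmin
  have hupper := h1_le_quadratic hS.1 hX hY ha hXa hYa
  have hlower := h1_ge_tangent hS hZ hY hZpos fun i => ha.trans_le (hYa i)
  rw [← hL] at hupper
  have hinner : L * frobInner (X - (Y - (1 / L) • gradH1 S Y)) (Z - X)
      = L * frobInner (X - Y) (Z - X) + frobInner (gradH1 S Y) (Z - X) := by
    simp only [frobInner_sub_left, frobInner_smul_left]
    field_simp
    ring
  have hsplit : frobInner (gradH1 S Y) (Z - Y)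
      = frobInner (gradH1 S Y) (Z - X) + frobInner (gradH1 S Y) (X - Y) := by
    simp only [frobInner_sub_right]
    ring
  have hpyth : frobSq (Z - Y)
      = frobSq (Z - X) + 2 * frobInner (X - Y) (Z - X) + frobSq (X - Y) := by
    simp only [frobSq_eq_frobInner, frobInner_sub_left, frobInner_sub_right,
      frobInner_comm Y, frobInner_comm Z X]
    ring
  rw [hinner] at hprox
  rw [hsplit] at hlower
  rw [hpyth, Qobj, Qobj]
  linarith

end Proximal

section Momentum

variable {p : ℕ}

lemma frobSq_momentum_identity (A B X Y : Matrix (Fin p) (Fin p) ℝ) (t : ℝ) :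
    t * ((t - 1) * (frobSq (A - Y) - frobSq (A - X)) + (frobSq (B - Y) - frobSq (B - X)))
      = frobSq (t • Y - (t - 1) • A - B) - frobSq (t • X - (t - 1) • A - B) := by
  simp only [frobSq, ← Finset.sum_sub_distrib, Finset.mul_sum, ← Finset.sum_add_distrib]
  refine Finset.sum_congr rfl fun i _ => Finset.sum_congr rfl fun j _ => ?_
  simp only [Matrix.sub_apply, Matrix.smul_apply, smul_eq_mul]
  ring

lemma half_succ_le_momentum {α : ℕ → ℝ} (hα1 : α 1 = 1)
    (hα : ∀ k : ℕ, 1 ≤ k → α (k + 1) = (1 + Real.sqrt (1 + 4 * (α k) ^ 2)) / 2)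
    {k : ℕ} (hk : 1 ≤ k) : ((k : ℝ) + 1) / 2 ≤ α k := by
  induction k, hk using Nat.le_induction with
  | base => norm_num [hα1]
  | succ k hk ih =>
    have h : 2 * α k ≤ Real.sqrt (1 + 4 * (α k) ^ 2) :=
      Real.le_sqrt_of_sq_le (by linarith [mul_pow 2 (α k) 2])
    rw [hα k hk]
    push_cast
    linarith

lemma momentum_sq_sub_self {α : ℕ → ℝ}
    (hα : ∀ k : ℕ, 1 ≤ k → α (k + 1) = (1 + Real.sqrt (1 + 4 * (α k) ^ 2)) / 2)
    {k : ℕ} (hk : 1 ≤ k) : α (k + 1) * (α (k + 1) - 1) = α k ^ 2 := by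
  have h := Real.sq_sqrt (show 0 ≤ 1 + 4 * (α k) ^ 2 by positivity)
  rw [hα k hk]
  linear_combination h / 4

end Momentum


/-- Theorem 3: `O(1/k²)` convergence of CONCORD-FISTA with constant step
size: with `L = a⁻² + ‖S‖₂`, `Θ^{(1)} = Ω^{(0)}`, `α_1 = 1`, and for `k ≥ 1`:
`Ω^{(k)} = argmin_{Θ symmetric} { h2(Θ) + (L/2)‖Θ − (Θ^{(k)} − (1/L)∇h1(Θ^{(k)}))‖_F² }`,
`α_{k+1} = (1 + √(1 + 4α_k²))/2`, `Θ^{(k+1)} = Ω^{(k)} + ((α_k − 1)/α_{k+1})(Ω^{(k)} −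
Ω^{(k−1)})`, with all iterates in `C`; if `Ω*` minimizes `Q` over `C` then
`Q(Ω^{(k)}) − Q(Ω*) ≤ 2L‖Ω^{(0)} − Ω*‖_F²/(k+1)²` for every `k ≥ 1`. -/
theorem concord_fista_convergence_rate
    {p : ℕ} (hp : 0 < p) (S : Matrix (Fin p) (Fin p) ℝ) (hS : S.PosSemidef)
    (lam : ℝ) (hlam : 0 < lam)
    (C : Set (Matrix (Fin p) (Fin p) ℝ)) (hC : Convex ℝ C)
    (hCsym : ∀ A ∈ C, Matrix.IsSymm A)
    (a b : ℝ) (ha : 0 < a) (hab : a ≤ b)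
    (hCdiag : ∀ A ∈ C, ∀ i, a ≤ A i i ∧ A i i ≤ b)
    (L : ℝ) (hL : L = (a ^ 2)⁻¹ + specNorm S hS.1)
    (Ω Θseq : ℕ → Matrix (Fin p) (Fin p) ℝ) (α : ℕ → ℝ)
    (hΘ1 : Θseq 1 = Ω 0) (hα1 : α 1 = 1)
    (hstep : ∀ k : ℕ, 1 ≤ k → (Ω k).IsSymm ∧
      ∀ Θ : Matrix (Fin p) (Fin p) ℝ, Θ.IsSymm →
        h2 lam (Ω k)
            + (L / 2) * frobSq (Ω k - (Θseq k - (1 / L) • gradH1 S (Θseq k)))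
          ≤ h2 lam Θ + (L / 2) * frobSq (Θ - (Θseq k - (1 / L) • gradH1 S (Θseq k))))
    (hα : ∀ k : ℕ, 1 ≤ k → α (k + 1) = (1 + Real.sqrt (1 + 4 * (α k) ^ 2)) / 2)
    (hmomentum : ∀ k : ℕ, 1 ≤ k →
      Θseq (k + 1) = Ω k + ((α k - 1) / α (k + 1)) • (Ω k - Ω (k - 1)))
    (hmemΩ : ∀ k : ℕ, Ω k ∈ C) (hmemΘ : ∀ k : ℕ, 1 ≤ k → Θseq k ∈ C)
    (Ωstar : Matrix (Fin p) (Fin p) ℝ) (hstar : Ωstar ∈ C)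
    (hstarmin : ∀ Θ ∈ C, Qobj S lam Ωstar ≤ Qobj S lam Θ) :
    ∀ k : ℕ, 1 ≤ k →
      Qobj S lam (Ω k) - Qobj S lam Ωstar
        ≤ 2 * L * frobSq (Ω 0 - Ωstar) / ((k : ℝ) + 1) ^ 2 := by
  have hL0 : 0 < L := by
    have := specNorm_nonneg hS
    rw [hL]
    positivity
  have hkey : ∀ k, 1 ≤ k → ∀ Z ∈ C, Qobj S lam (Ω k) ≤ Qobj S lam Z
      + L / 2 * (frobSq (Z - Θseq k) - frobSq (Z - Ω k)) := fun k hk Z hZ =>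
    Qobj_prox_step_le hS hlam.le ha hL (hstep k hk).1 (hCsym _ (hmemΘ k hk)) (hCsym Z hZ)
      (fun i => (hCdiag _ (hmemΩ k) i).1) (fun i => (hCdiag _ (hmemΘ k hk) i).1)
      (fun i => ha.trans_le (hCdiag Z hZ i).1) (hstep k hk).2
  have hpot : ∀ k, 1 ≤ k → α k ^ 2 * (Qobj S lam (Ω k) - Qobj S lam Ωstar)
      + L / 2 * frobSq (α k • Ω k - (α k - 1) • Ω (k - 1) - Ωstar)
      ≤ L / 2 * frobSq (Ω 0 - Ωstar) := by
    intro k hk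
    induction k, hk using Nat.le_induction with
    | base =>
      have h := hkey 1 le_rfl Ωstar hstar
      have hid := frobSq_momentum_identity (Ω 0) Ωstar (Ω 1) (Θseq 1) 1
      simp only [hα1, hΘ1, sub_self, zero_smul, one_smul, sub_zero, zero_mul, zero_add,
        one_mul, one_pow] at h hid ⊢
      rw [hid] at h
      linarith
    | succ k hk ih =>
      have hαk := half_succ_le_momentum hα1 hα (Nat.le_succ_of_le hk)
      have hk1 : (1 : ℝ) ≤ k := by exact_mod_cast hk
      push_cast at hαk
      have hone : 1 ≤ α (k + 1) := by linarith
      have hA := mul_le_mul_of_nonneg_left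
        (hkey (k + 1) (Nat.le_add_left 1 k) (Ω k) (hmemΩ k)) (sub_nonneg.2 hone)
      have hB := hkey (k + 1) (Nat.le_add_left 1 k) Ωstar hstar
      have hAB := mul_le_mul_of_nonneg_left (add_le_add hA hB) (zero_le_one.trans hone)
      have hid := frobSq_momentum_identity (Ω k) Ωstar (Ω (k + 1)) (Θseq (k + 1)) (α (k + 1))
      have hmom : α (k + 1) • Θseq (k + 1) - (α (k + 1) - 1) • Ω k
          = α k • Ω k - (α k - 1) • Ω (k - 1) := by
        rw [hmomentum k hk, smul_add, smul_smul,
          mul_div_cancel₀ _ (zero_lt_one.trans_le hone).ne']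
        module
      have hsq := momentum_sq_sub_self hα hk
      rw [hmom] at hid
      rw [Nat.add_sub_cancel]
      rw [← hsq] at ih
      linear_combination hAB + ih + L / 2 * hid
  intro k hk
  have hp := hpot k hk
  have hnn := mul_nonneg (half_pos hL0).le
    (frobSq_nonneg (α k • Ω k - (α k - 1) • Ω (k - 1) - Ωstar))
  have hv : 0 ≤ Qobj S lam (Ω k) - Qobj S lam Ωstar :=
    sub_nonneg.2 (hstarmin _ (hmemΩ k))
  have hsq : (((k : ℝ) + 1) / 2) ^ 2 ≤ α k ^ 2 :=
    pow_le_pow_left₀ (by positivity) (half_succ_le_momentum hα1 hα hk) 2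
  have hmul := mul_le_mul_of_nonneg_right hsq hv
  rw [le_div_iff₀ (by positivity)]
  linarith
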